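/- arXiv:2211.10874 — 2 statements merged into one kernel-verified Lean document; each statement's English description precedes it below -/
import Mathlib

section
/- Let n ≥ 2, let m = (m_1,…,m_n) be real numbers with all m_j > 0, fix 1 ≤ i ≤ n−1 and ρ ∈ ℝ. Then for all δh, δv ∈ ℝ^n, Q_1(R_iᵀ(δh + S_i(ρ) δv), R_i δv) = Q_1(δh, δv) + α_i(ρ)·(δv_i − δv_{i+1})², where α_i(ρ) = 2 m_i m_{i+1} (m_i − m_{i+1}) ρ / (m_i + m_{i+1})². In particular, the ball-to-ball collision map D_{(i,ρ)} increases the form Q_1 by exactly α_i(ρ)(δv_i − δv_{i+1})². -/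
open Matrix BigOperators

/-- `γ_i = (m_i - m_{i+1})/(m_i + m_{i+1})` (masses indexed 1-based). -/
noncomputable def gammaC (m : ℕ → ℝ) (i : ℕ) : ℝ := (m i - m (i + 1)) / (m i + m (i + 1))

/-- `α_i(ρ) = 2 m_i m_{i+1} (m_i - m_{i+1}) ρ / (m_i + m_{i+1})²`. -/
noncomputable def alphaC (m : ℕ → ℝ) (i : ℕ) (ρ : ℝ) : ℝ :=
  2 * m i * m (i + 1) * (m i - m (i + 1)) * ρ / (m i + m (i + 1)) ^ 2

/-- The collision matrix `R_i` (1 ≤ i ≤ n-1); particles are 1-based, so particle `i`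
has 0-based index `i - 1` (i.e. `a : Fin n` with `a + 1 = i`).  `R_0 = I`. -/
noncomputable def Rmat (n : ℕ) (m : ℕ → ℝ) (i : ℕ) : Matrix (Fin n) (Fin n) ℝ :=
  if i = 0 then 1 else
    Matrix.of fun a b =>
      if (a : ℕ) + 1 = i ∧ (b : ℕ) + 1 = i then gammaC m i
      else if (a : ℕ) + 1 = i ∧ (b : ℕ) = i then 1 - gammaC m i
      else if (a : ℕ) = i ∧ (b : ℕ) + 1 = i then 1 + gammaC m i
      else if (a : ℕ) = i ∧ (b : ℕ) = i then -(gammaC m i)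
      else if a = b then 1 else 0

/-- The matrix `S_i(ρ)` (zero unless 1 ≤ i ≤ n-1). -/
noncomputable def Smat (n : ℕ) (m : ℕ → ℝ) (i : ℕ) (ρ : ℝ) : Matrix (Fin n) (Fin n) ℝ :=
  if i = 0 then 0 else
    Matrix.of fun a b =>
      if (a : ℕ) + 1 = i ∧ (b : ℕ) + 1 = i then alphaC m i ρ
      else if (a : ℕ) + 1 = i ∧ (b : ℕ) = i then -(alphaC m i ρ)
      else if (a : ℕ) = i ∧ (b : ℕ) + 1 = i then -(alphaC m i ρ)
      else if (a : ℕ) = i ∧ (b : ℕ) = i then alphaC m i ρ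
      else 0

/-- The quadratic form `Q₁(δh, δv) = Σ_j δh_j δv_j`. -/
noncomputable def Qform (n : ℕ) (x : (Fin n → ℝ) × (Fin n → ℝ)) : ℝ :=
  ∑ j, x.1 j * x.2 j

/-- The collision map `D_{(i,ρ)}`: floor collision when `i = 0`,
ball-to-ball collision `(i, i+1)` when `1 ≤ i ≤ n-1`. -/
noncomputable def Dmap (n : ℕ) (m : ℕ → ℝ) (i : ℕ) (ρ : ℝ)
    (x : (Fin n → ℝ) × (Fin n → ℝ)) : (Fin n → ℝ) × (Fin n → ℝ) :=
  if i = 0 then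
    (x.1, fun j => x.2 j + if (j : ℕ) = 0 then 2 * x.1 j / (m 1 * ρ) else 0)
  else
    ((Rmat n m i)ᵀ *ᵥ (x.1 + Smat n m i ρ *ᵥ x.2), Rmat n m i *ᵥ x.2)

/-- Composition `D_{(i_N,ρ_N)} ∘ ⋯ ∘ D_{(i_1,ρ_1)}` along an extended symbolic sequence,
given as the list `[(i_1,ρ_1), …, (i_N,ρ_N)]`. -/
noncomputable def Dcomp (n : ℕ) (m : ℕ → ℝ) :
    List (ℕ × ℝ) → ((Fin n → ℝ) × (Fin n → ℝ)) → ((Fin n → ℝ) × (Fin n → ℝ))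
  | [], x => x
  | c :: rest, x => Dcomp n m rest (Dmap n m c.1 c.2 x)

/-- `Rprod [i_1, …, i_k] = R_{i_k}ᵀ ⋯ R_{i_2}ᵀ R_{i_1}ᵀ`. -/
noncomputable def Rprod (n : ℕ) (m : ℕ → ℝ) : List ℕ → Matrix (Fin n) (Fin n) ℝ
  | [] => 1
  | i :: rest => Rprod n m rest * (Rmat n m i)ᵀ

/-- The neutral space `N(Σ, m)`: vectors `δh` with `Σ_j δh_j = 0` such that for every
prefix of `Σ` ending with a floor collision, the first entry of the corresponding
product `R_{i_k}ᵀ ⋯ R_{i_1}ᵀ δh` vanishes. -/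
noncomputable def NeutralSpace (n : ℕ) (m : ℕ → ℝ) (Sl : List ℕ) : Set (Fin n → ℝ) :=
  {δh | (∑ j, δh j) = 0 ∧
    ∀ p : List ℕ, p <+: Sl → p.getLast? = some 0 →
      ∀ a : Fin n, (a : ℕ) = 0 → (Rprod n m p *ᵥ δh) a = 0}

/-- An admissible mass vector: `m_1 > m_2 > … > m_n > 0` (1-based indexing). -/
def Admissible (n : ℕ) (m : ℕ → ℝ) : Prop :=
  (∀ i : ℕ, 1 ≤ i → i < n → m (i + 1) < m i) ∧ 0 < m n

/-- `Rmat` is a rank-one perturbation of the identity. -/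
lemma Rmat_eq_one_add_vecMulVec {n : ℕ} (m : ℕ → ℝ) {i : ℕ} (p q : Fin n)
    (hp : (p : ℕ) + 1 = i) (hq : (q : ℕ) = i) :
    Rmat n m i = 1 + vecMulVec
      ((gammaC m i - 1) • Pi.single p 1 + (1 + gammaC m i) • Pi.single q 1)
      (Pi.single p 1 - Pi.single q 1) := by
  have hpq : p ≠ q := by rintro rfl; omega
  have hpi (a : Fin n) : (a : ℕ) + 1 = i ↔ a = p := by rw [Fin.ext_iff]; omega
  have hqi (a : Fin n) : (a : ℕ) = i ↔ a = q := by rw [Fin.ext_iff]; omega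
  have hi : i ≠ 0 := by omega
  ext a b
  simp only [Rmat, hi, if_false, of_apply, hpi, hqi, Matrix.add_apply, one_apply,
    vecMulVec_apply, Pi.add_apply, Pi.sub_apply, Pi.smul_apply, Pi.single_apply, smul_eq_mul]
  by_cases hap : a = p <;> by_cases haq : a = q <;> by_cases hbp : b = p <;>
    by_cases hbq : b = q <;> simp_all [hpq.symm]

/-- `Smat` is a multiple of a rank-one symmetric matrix. -/
lemma Smat_eq_smul_vecMulVec {n : ℕ} (m : ℕ → ℝ) {i : ℕ} (ρ : ℝ) (p q : Fin n)
    (hp : (p : ℕ) + 1 = i) (hq : (q : ℕ) = i) :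
    Smat n m i ρ = alphaC m i ρ • vecMulVec
      (Pi.single p 1 - Pi.single q 1) (Pi.single p 1 - Pi.single q 1) := by
  have hpq : p ≠ q := by rintro rfl; omega
  have hpi (a : Fin n) : (a : ℕ) + 1 = i ↔ a = p := by rw [Fin.ext_iff]; omega
  have hqi (a : Fin n) : (a : ℕ) = i ↔ a = q := by rw [Fin.ext_iff]; omega
  have hi : i ≠ 0 := by omega
  ext a b
  simp only [Smat, hi, if_false, of_apply, hpi, hqi, Matrix.smul_apply,
    vecMulVec_apply, Pi.sub_apply, Pi.single_apply, smul_eq_mul]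
  by_cases hap : a = p <;> by_cases haq : a = q <;> by_cases hbp : b = p <;>
    by_cases hbq : b = q <;> simp_all [hpq.symm]

/-- The collision matrix is an involution. -/
lemma Rmat_mul_self {n : ℕ} (m : ℕ → ℝ) {i : ℕ} (p q : Fin n)
    (hp : (p : ℕ) + 1 = i) (hq : (q : ℕ) = i) : Rmat n m i * Rmat n m i = 1 := by
  have hpq : p ≠ q := by rintro rfl; omega
  rw [Rmat_eq_one_add_vecMulVec m p q hp hq]
  set w : Fin n → ℝ := Pi.single p 1 - Pi.single q 1 with hw
  set u : Fin n → ℝ :=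
    (gammaC m i - 1) • Pi.single p 1 + (1 + gammaC m i) • Pi.single q 1 with hu
  have hwu : w ⬝ᵥ u = -2 := by
    simp [hw, hu, hpq, hpq.symm]
    ring
  rw [add_mul, mul_add, mul_add, vecMulVec_mul_vecMulVec, hwu]
  ext a b
  simp [vecMulVec_apply]
  ring

/-- A ball-to-ball collision `(i, i+1)` increases `Q₁` by exactly
`α_i(ρ)·(δv_i − δv_{i+1})²`. -/
theorem ball_collision_Q_increase (n : ℕ) (hn : 2 ≤ n) (m : ℕ → ℝ)
    (hpos : ∀ j : ℕ, 1 ≤ j → j ≤ n → 0 < m j)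
    (i : ℕ) (hi1 : 1 ≤ i) (hi2 : i ≤ n - 1) (ρ : ℝ) :
    ∀ δh δv : Fin n → ℝ,
      Qform n ((Rmat n m i)ᵀ *ᵥ (δh + Smat n m i ρ *ᵥ δv), Rmat n m i *ᵥ δv)
          = Qform n (δh, δv)
            + alphaC m i ρ * (δv ⟨i - 1, by omega⟩ - δv ⟨i, by omega⟩) ^ 2 ∧
        Qform n (Dmap n m i ρ (δh, δv))
          = Qform n (δh, δv)
            + alphaC m i ρ * (δv ⟨i - 1, by omega⟩ - δv ⟨i, by omega⟩) ^ 2 := by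
  intro δh δv
  set p : Fin n := ⟨i - 1, by omega⟩
  set q : Fin n := ⟨i, by omega⟩
  have hp : (p : ℕ) + 1 = i := Nat.sub_add_cancel hi1
  have hq : (q : ℕ) = i := rfl
  have hQ : Qform n ((Rmat n m i)ᵀ *ᵥ (δh + Smat n m i ρ *ᵥ δv), Rmat n m i *ᵥ δv)
      = Qform n (δh, δv) + alphaC m i ρ * (δv p - δv q) ^ 2 := by
    change ((Rmat n m i)ᵀ *ᵥ (δh + Smat n m i ρ *ᵥ δv)) ⬝ᵥ (Rmat n m i *ᵥ δv)
      = δh ⬝ᵥ δv + alphaC m i ρ * (δv p - δv q) ^ 2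
    rw [mulVec_transpose, ← dotProduct_mulVec, mulVec_mulVec, Rmat_mul_self m p q hp hq,
      one_mulVec, add_dotProduct, Smat_eq_smul_vecMulVec m ρ p q hp hq, smul_mulVec,
      vecMulVec_mulVec]
    simp [sub_dotProduct, pow_two]
  refine ⟨hQ, ?_⟩
  rw [Dmap, if_neg (by omega)]
  exact hQ
end

section
/- Let n ≥ 2 and m_1 > m_2 > … > m_n > 0. Let Σ = (σ_1,…,σ_N) be a symbolic collision sequence with parameters ρ_1,…,ρ_N > 0 such that every ball-to-ball collision type (i,i+1), 1 ≤ i ≤ n−1, occurs in Σ. Then a vector (δh, δv) in the reduced subspace V satisfies Q_1(D_{(i_k,ρ_k)} ∘ ⋯ ∘ D_{(i_1,ρ_1)}(δh, δv)) = 0 for every k = 0, 1, …, N (the case k = 0 meaning Q_1(δh,δv) = 0) if and only if δv = 0 and δh belongs to the neutral space N(Σ, m). In particular, along such a neutral vector the δv-component remains identically zero and the δh-component evolves only by δh ↦ R_iᵀ δh at ball-to-ball collisions, while every floor collision forces the first component of the current δh to vanish. -/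
open Matrix BigOperators

theorem Admissible.pos {n : ℕ} {m : ℕ → ℝ} (hm : Admissible n m) {i : ℕ}
    (hi : 1 ≤ i) (hin : i ≤ n) : 0 < m i := by
  induction hin using Nat.decreasingInduction with
  | self => exact hm.2
  | of_succ k hk ih => exact (ih (by omega)).trans (hm.1 k hi hk)

theorem Admissible.alphaC_pos {n : ℕ} {m : ℕ → ℝ} (hm : Admissible n m) {i : ℕ}
    (hi : 1 ≤ i) (hin : i < n) {ρ : ℝ} (hρ : 0 < ρ) : 0 < alphaC m i ρ := by
  have h₁ := hm.pos hi hin.le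
  have h₂ := hm.pos (i := i + 1) (by omega) hin
  have h₃ := sub_pos.2 (hm.1 i hi hin)
  unfold alphaC
  positivity

/-- `R_i` is a rank-one perturbation of the identity. -/
theorem Rmat_succ (n : ℕ) (m : ℕ → ℝ) (k : ℕ) (hk : k + 1 < n) :
    Rmat n m (k + 1) = 1 + vecMulVec
      (Pi.single ⟨k, by omega⟩ (1 - gammaC m (k + 1)) -
        Pi.single ⟨k + 1, hk⟩ (1 + gammaC m (k + 1)))
      (Pi.single ⟨k + 1, hk⟩ 1 - Pi.single ⟨k, by omega⟩ 1) := by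
  ext a b
  simp only [Rmat, Nat.succ_ne_zero, if_false, of_apply, Matrix.add_apply, one_apply,
    vecMulVec_apply, Pi.sub_apply, Pi.single_apply, Fin.ext_iff]
  split_ifs <;> first | omega | ring

theorem Smat_succ (n : ℕ) (m : ℕ → ℝ) (k : ℕ) (hk : k + 1 < n) (ρ : ℝ) :
    Smat n m (k + 1) ρ = vecMulVec
      (Pi.single ⟨k, by omega⟩ (alphaC m (k + 1) ρ) -
        Pi.single ⟨k + 1, hk⟩ (alphaC m (k + 1) ρ))
      (Pi.single ⟨k, by omega⟩ 1 - Pi.single ⟨k + 1, hk⟩ 1) := by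
  ext a b
  simp only [Smat, Nat.succ_ne_zero, if_false, of_apply,
    vecMulVec_apply, Pi.sub_apply, Pi.single_apply, Fin.ext_iff]
  split_ifs <;> first | omega | ring

theorem Rmat_succ_mulVec (n : ℕ) (m : ℕ → ℝ) (k : ℕ) (hk : k + 1 < n) (v : Fin n → ℝ) :
    Rmat n m (k + 1) *ᵥ v = v + (v ⟨k + 1, hk⟩ - v ⟨k, by omega⟩) •
      (Pi.single ⟨k, by omega⟩ (1 - gammaC m (k + 1)) -
        Pi.single ⟨k + 1, hk⟩ (1 + gammaC m (k + 1))) := by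
  rw [Rmat_succ n m k hk, add_mulVec, one_mulVec, vecMulVec_mulVec, sub_dotProduct,
    single_one_dotProduct, single_one_dotProduct, op_smul_eq_smul]

theorem Smat_succ_mulVec (n : ℕ) (m : ℕ → ℝ) (k : ℕ) (hk : k + 1 < n) (ρ : ℝ)
    (v : Fin n → ℝ) :
    Smat n m (k + 1) ρ *ᵥ v = (v ⟨k, by omega⟩ - v ⟨k + 1, hk⟩) •
      (Pi.single ⟨k, by omega⟩ (alphaC m (k + 1) ρ) -
        Pi.single ⟨k + 1, hk⟩ (alphaC m (k + 1) ρ)) := by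
  rw [Smat_succ n m k hk, vecMulVec_mulVec, sub_dotProduct,
    single_one_dotProduct, single_one_dotProduct, op_smul_eq_smul]

theorem Rmat_succ_mulVec_mulVec (n : ℕ) (m : ℕ → ℝ) (k : ℕ) (hk : k + 1 < n)
    (v : Fin n → ℝ) : Rmat n m (k + 1) *ᵥ (Rmat n m (k + 1) *ᵥ v) = v := by
  rw [Rmat_succ_mulVec n m k hk (Rmat n m (k + 1) *ᵥ v), Rmat_succ_mulVec n m k hk v]
  ext j
  simp [Pi.single_apply]
  ring

theorem Qform_eq_dotProduct (n : ℕ) (x : (Fin n → ℝ) × (Fin n → ℝ)) :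
    Qform n x = x.1 ⬝ᵥ x.2 := rfl

theorem Qform_Dmap_succ (n : ℕ) (m : ℕ → ℝ) (k : ℕ) (hk : k + 1 < n) (ρ : ℝ)
    (h v : Fin n → ℝ) :
    Qform n (Dmap n m (k + 1) ρ (h, v)) =
      Qform n (h, v) + alphaC m (k + 1) ρ * (v ⟨k, by omega⟩ - v ⟨k + 1, hk⟩) ^ 2 := by
  simp only [Dmap, Nat.succ_ne_zero, if_false, Qform_eq_dotProduct]
  rw [mulVec_transpose, ← dotProduct_mulVec, Rmat_succ_mulVec_mulVec n m k hk,
    add_dotProduct, Smat_succ_mulVec n m k hk, smul_dotProduct, sub_dotProduct,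
    single_dotProduct, single_dotProduct, smul_eq_mul]
  ring

theorem Qform_Dmap_zero (n : ℕ) (m : ℕ → ℝ) (hn : 0 < n) (ρ : ℝ) (h v : Fin n → ℝ) :
    Qform n (Dmap n m 0 ρ (h, v)) = Qform n (h, v) + 2 * h ⟨0, hn⟩ ^ 2 / (m 1 * ρ) := by
  have key : ∀ j : Fin n, h j * (v j + if (j : ℕ) = 0 then 2 * h j / (m 1 * ρ) else 0) =
      h j * v j + if j = ⟨0, hn⟩ then 2 * h j ^ 2 / (m 1 * ρ) else 0 := by
    intro j
    simp only [Fin.ext_iff]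
    split_ifs <;> ring
  simp [Dmap, Qform, key, Finset.sum_add_distrib]

theorem Dmap_zero_of_floor (n : ℕ) (m : ℕ → ℝ) (hn : 0 < n) (ρ : ℝ) (h v : Fin n → ℝ)
    (h0 : h ⟨0, hn⟩ = 0) : Dmap n m 0 ρ (h, v) = ((Rmat n m 0)ᵀ *ᵥ h, v) := by
  have key : ∀ j : Fin n, (j : ℕ) = 0 → h j = 0 := fun j hj => by
    rwa [show j = ⟨0, hn⟩ from Fin.ext hj]
  ext j
  · simp [Dmap, Rmat]
  · simp only [Dmap, if_true]
    split_ifs with hj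
    · simp [key j hj]
    · simp

theorem Dmap_succ_of_eq (n : ℕ) (m : ℕ → ℝ) (k : ℕ) (hk : k + 1 < n) (ρ : ℝ)
    (h v : Fin n → ℝ) (hv : v ⟨k, by omega⟩ = v ⟨k + 1, hk⟩) :
    Dmap n m (k + 1) ρ (h, v) = ((Rmat n m (k + 1))ᵀ *ᵥ h, v) := by
  simp only [Dmap, Nat.succ_ne_zero, if_false]
  rw [Rmat_succ_mulVec n m k hk, Smat_succ_mulVec n m k hk, hv]
  simp

/-- Along the sequence of collision types `l`, the evolution of `h` by the `R_iᵀ` has vanishing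
first entry at every floor collision. -/
def FloorVanishing (n : ℕ) (m : ℕ → ℝ) (l : List ℕ) (h : Fin n → ℝ) : Prop :=
  ∀ p : List ℕ, p <+: l → p.getLast? = some 0 →
    ∀ a : Fin n, (a : ℕ) = 0 → (Rprod n m p *ᵥ h) a = 0

theorem floorVanishing_nil (n : ℕ) (m : ℕ → ℝ) (h : Fin n → ℝ) :
    FloorVanishing n m [] h := by
  intro p hp hlast
  simp [List.prefix_nil.1 hp] at hlast

theorem floorVanishing_cons (n : ℕ) (m : ℕ → ℝ) (hn : 0 < n) (i : ℕ) (l : List ℕ)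
    (h : Fin n → ℝ) :
    FloorVanishing n m (i :: l) h ↔
      (i = 0 → h ⟨0, hn⟩ = 0) ∧ FloorVanishing n m l ((Rmat n m i)ᵀ *ᵥ h) := by
  constructor
  · refine fun H => ⟨?_, fun p hp hlast a ha => ?_⟩
    · rintro rfl
      simpa [Rprod, Rmat] using H [0] (by simp) rfl ⟨0, hn⟩ rfl
    · have := H (i :: p) (by simpa using hp) (by simp [List.getLast?_cons, hlast]) a ha
      simpa [Rprod, mulVec_mulVec] using this
  · rintro ⟨h0, H⟩ p hp hlast a ha
    obtain ⟨rfl⟩ | ⟨q, rfl, hq⟩ := List.prefix_cons_iff.1 hp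
    · simp at hlast
    · rw [Rprod, ← mulVec_mulVec]
      cases q with
      | nil =>
        obtain rfl : i = 0 := by simpa using hlast
        rw [show a = ⟨0, hn⟩ from Fin.ext ha]
        simpa [Rprod, Rmat] using h0 rfl
      | cons b q => exact H _ hq (by simpa [List.getLast?_cons_cons] using hlast) a ha

theorem Dmap_eq_of_Qform_eq_zero {n : ℕ} {m : ℕ → ℝ} (hm : Admissible n m) (hn : 0 < n)
    {i : ℕ} {ρ : ℝ} (hi : i < n) (hρ : 0 < ρ) {h v : Fin n → ℝ}
    (hQ : Qform n (h, v) = 0) (hQ' : Qform n (Dmap n m i ρ (h, v)) = 0) :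
    Dmap n m i ρ (h, v) = ((Rmat n m i)ᵀ *ᵥ h, v) ∧ (i = 0 → h ⟨0, hn⟩ = 0) ∧
      ∀ a b : Fin n, (a : ℕ) + 1 = i → (b : ℕ) = i → v a = v b := by
  cases i with
  | zero =>
    have h0 : h ⟨0, hn⟩ = 0 := by
      have := mul_pos (hm.pos le_rfl hn) hρ
      rw [Qform_Dmap_zero n m hn, hQ] at hQ'
      simpa [this.ne'] using hQ'
    exact ⟨Dmap_zero_of_floor n m hn ρ h v h0, fun _ => h0, fun a b ha => by omega⟩
  | succ k =>
    have hv : v ⟨k, by omega⟩ = v ⟨k + 1, hi⟩ := by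
      rw [Qform_Dmap_succ n m k hi, hQ, zero_add] at hQ'
      simpa [(hm.alphaC_pos (by omega) hi hρ).ne', sub_eq_zero] using hQ'
    refine ⟨Dmap_succ_of_eq n m k hi ρ h v hv, by simp, fun a b ha hb => ?_⟩
    convert hv using 2
    exacts [Fin.ext (by simpa using ha), Fin.ext hb]

theorem floorVanishing_of_Qform_eq_zero {n : ℕ} {m : ℕ → ℝ} (hm : Admissible n m)
    (hn : 0 < n) (v : Fin n → ℝ) (L : List (ℕ × ℝ)) (hL : ∀ c ∈ L, c.1 < n ∧ 0 < c.2)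
    (h : Fin n → ℝ) (hQ : ∀ p : List (ℕ × ℝ), p <+: L → Qform n (Dcomp n m p (h, v)) = 0) :
    FloorVanishing n m (L.map Prod.fst) h ∧
      ∀ c ∈ L, ∀ a b : Fin n, (a : ℕ) + 1 = c.1 → (b : ℕ) = c.1 → v a = v b := by
  induction L generalizing h with
  | nil => exact ⟨floorVanishing_nil n m h, by simp⟩
  | cons c L ih =>
    obtain ⟨hc, hL⟩ := List.forall_mem_cons.1 hL
    obtain ⟨hD, h0, hv⟩ := Dmap_eq_of_Qform_eq_zero hm hn hc.1 hc.2
      (hQ [] List.nil_prefix) (hQ [c] (by simp))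
    obtain ⟨hF, hv'⟩ := ih hL _ fun p hp => by
      simpa [Dcomp, hD] using hQ (c :: p) (by simpa using hp)
    rw [List.map_cons, floorVanishing_cons n m hn]
    exact ⟨⟨h0, hF⟩, List.forall_mem_cons.2 ⟨hv, hv'⟩⟩

theorem Dcomp_eq_of_floorVanishing {n : ℕ} (m : ℕ → ℝ) (hn : 0 < n)
    (L : List (ℕ × ℝ)) (hL : ∀ c ∈ L, c.1 < n) (h : Fin n → ℝ)
    (hF : FloorVanishing n m (L.map Prod.fst) h) :
    Dcomp n m L (h, 0) = (Rprod n m (L.map Prod.fst) *ᵥ h, 0) := by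
  induction L generalizing h with
  | nil => simp [Dcomp, Rprod]
  | cons c L ih =>
    obtain ⟨hc, hL⟩ := List.forall_mem_cons.1 hL
    rw [List.map_cons, floorVanishing_cons n m hn] at hF
    have hD : Dmap n m c.1 c.2 (h, 0) = ((Rmat n m c.1)ᵀ *ᵥ h, 0) := by
      obtain ⟨_ | k, ρ⟩ := c
      · exact Dmap_zero_of_floor n m hn ρ h 0 (hF.1 rfl)
      · exact Dmap_succ_of_eq n m k hc ρ h 0 rfl
    rw [Dcomp, hD, ih hL _ hF.2, List.map_cons, Rprod, mulVec_mulVec]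

theorem eq_zero_of_consecutive_eq_of_sum_eq_zero {n : ℕ} (hn : 0 < n) {v : Fin n → ℝ}
    (hv : ∀ a b : Fin n, (b : ℕ) = a + 1 → v a = v b) (hsum : ∑ j, v j = 0) : v = 0 := by
  have hconst : ∀ (k : ℕ) (hk : k < n), v ⟨k, hk⟩ = v ⟨0, hn⟩ := by
    intro k
    induction k with
    | zero => exact fun _ => rfl
    | succ k ih => exact fun hk => (hv ⟨k, by omega⟩ ⟨k + 1, hk⟩ rfl).symm.trans (ih _)
  have h0 : v ⟨0, hn⟩ = 0 := by
    rw [Finset.sum_congr rfl fun (j : Fin n) _ => hconst j j.isLt] at hsum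
    simpa [hn.ne'] using hsum
  exact funext fun j => (hconst j j.isLt).trans h0

/-- Characterization of neutral vectors: a vector `(δh, δv)` in the reduced
subspace `V` has `Q₁ = 0` along every prefix of the collision sequence iff `δv = 0` and
`δh` lies in the neutral space `N(Σ, m)`.  In particular, along such a neutral vector the
`δv`-component remains zero and the `δh`-component evolves only by `δh ↦ R_iᵀ δh`. -/
theorem neutral_vector_characterization (n : ℕ) (hn : 2 ≤ n) (m : ℕ → ℝ)
    (hm : Admissible n m)
    (L : List (ℕ × ℝ)) (hL : ∀ c ∈ L, c.1 ≤ n - 1 ∧ 0 < c.2)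
    (hall : ∀ i : ℕ, 1 ≤ i → i ≤ n - 1 → ∃ ρ : ℝ, (i, ρ) ∈ L)
    (δh δv : Fin n → ℝ) (hV : (∑ j, δh j) = 0 ∧ (∑ j, δv j) = 0) :
    ((∀ p : List (ℕ × ℝ), p <+: L → Qform n (Dcomp n m p (δh, δv)) = 0) ↔
        δv = 0 ∧ δh ∈ NeutralSpace n m (L.map Prod.fst)) ∧
      (δh ∈ NeutralSpace n m (L.map Prod.fst) →
        ∀ p : List (ℕ × ℝ), p <+: L →
          Dcomp n m p (δh, 0) = (Rprod n m (p.map Prod.fst) *ᵥ δh, 0)) := by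
  have hn0 : 0 < n := by omega
  have hL' : ∀ c ∈ L, c.1 < n ∧ 0 < c.2 := fun c hc =>
    ⟨by have := (hL c hc).1; omega, (hL c hc).2⟩
  have evol : δh ∈ NeutralSpace n m (L.map Prod.fst) → ∀ p : List (ℕ × ℝ), p <+: L →
      Dcomp n m p (δh, 0) = (Rprod n m (p.map Prod.fst) *ᵥ δh, 0) := fun hN p hp =>
    Dcomp_eq_of_floorVanishing m hn0 p (fun c hc => (hL' c (hp.subset hc)).1) δh
      fun q hq => hN.2 q (hq.trans (hp.map Prod.fst))
  refine ⟨⟨fun hQ => ?_, ?_⟩, evol⟩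
  · obtain ⟨hF, hv⟩ := floorVanishing_of_Qform_eq_zero hm hn0 δv L hL' δh hQ
    refine ⟨eq_zero_of_consecutive_eq_of_sum_eq_zero hn0 (fun a b hab => ?_) hV.2, hV.1, hF⟩
    obtain ⟨ρ, hρ⟩ := hall b (by omega) (by omega)
    exact hv _ hρ a b hab.symm rfl
  · rintro ⟨rfl, hN⟩ p hp
    rw [evol hN p hp]
    simp [Qform]
end
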